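/- For every s ≥ 1, the number of points of the projective space P^3(F_{7^s}) on which the homogeneous polynomial f(X_0, X_1, X_2, X_3) = −X_0^2 + X_1^2 + X_2^2 + X_3^2 vanishes equals 1 + 7^s + (−7)^s + 49^s. -/

import Mathlib

open scoped LinearAlgebra.Projectivization

section QuadricCount

variable {K V : Type*} [Field K] [AddCommGroup V] [Module K V]

/-- A subset of a vector space stable under nonzero scalars has, away from the origin, as many
vectors as pairs of a point of the projective space lying on it and a nonzero scalar. -/
theorem Projectivization.card_ne_zero_and_eq_mul_card_units (P : V → Prop)
    (hP : ∀ (a : Kˣ) (v : V), P (a • v) ↔ P v) :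
    Nat.card {v : V // v ≠ 0 ∧ P v} = Nat.card {p : ℙ K V // P p.rep} * Nat.card Kˣ := by
  rw [← Nat.card_prod]
  symm
  refine Nat.card_congr (Equiv.ofBijective
    (fun x : {p : ℙ K V // P p.rep} × Kˣ =>
      (⟨x.2 • x.1.1.rep, (smul_ne_zero_iff_ne x.2).2 x.1.1.rep_nonzero, (hP _ _).2 x.1.2⟩ :
        {v : V // v ≠ 0 ∧ P v})) ⟨?_, ?_⟩)
  · rintro ⟨⟨p, hp⟩, a⟩ ⟨⟨p', hp'⟩, b⟩ h
    have h : a • p.rep = b • p'.rep := congrArg Subtype.val h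
    have hpp : p = p' := by
      rw [← p.mk_rep, ← p'.mk_rep, Projectivization.mk_eq_mk_iff]
      exact ⟨a⁻¹ * b, by rw [mul_smul, ← h, inv_smul_smul]⟩
    subst hpp
    have hab : (a : K) = b := smul_left_injective K p.rep_nonzero h
    simp [Units.ext hab]
  · rintro ⟨v, hv, hPv⟩
    obtain ⟨a, ha⟩ := Projectivization.exists_smul_eq_mk_rep K v hv
    refine ⟨(⟨Projectivization.mk K v hv, by rw [← ha]; exact (hP _ _).2 hPv⟩, a⁻¹), ?_⟩
    simp [← ha]

variable (F : Type*) [Field F] [Fintype F]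

theorem card_mul_eq [DecidableEq F] (c : F) :
    (Nat.card {p : F × F // p.1 * p.2 = c} : ℤ) =
      Fintype.card F - 1 + if c = 0 then (Fintype.card F : ℤ) else 0 := by
  have h (a : F) : (Nat.card {b : F // a * b = c} : ℤ) =
      if a = 0 then (if c = 0 then (Fintype.card F : ℤ) else 0) else 1 := by
    split_ifs with ha hc
    · subst ha hc
      simp
    · subst ha
      simp [Ne.symm hc]
    · have : Unique {b : F // a * b = c} :=
        { default := ⟨a⁻¹ * c, mul_inv_cancel_left₀ ha c⟩
          uniq := fun b => Subtype.ext (by simp [← b.2, ha]) }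
      simp
  rw [Nat.card_congr (Equiv.subtypeProdEquivSigmaSubtype fun a b : F => a * b = c),
    Nat.card_sigma]
  push_cast
  rw [Finset.sum_congr rfl fun a _ => h a, Finset.sum_ite, Finset.filter_eq']
  simp [Finset.filter_ne', Finset.card_erase_of_mem, Nat.cast_sub Fintype.card_pos]
  ring

theorem card_sq_add_sq_eq_zero [DecidableEq F] (hF : ringChar F ≠ 2) :
    (Nat.card {p : F × F // p.1 ^ 2 + p.2 ^ 2 = 0} : ℤ) =
      Fintype.card F + (Fintype.card F - 1) * quadraticChar F (-1) := by
  have h (a : F) : (Nat.card {b : F // a ^ 2 + b ^ 2 = 0} : ℤ) =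
      (if a = 0 then 0 else quadraticChar F (-1)) + 1 := by
    have hs : (Nat.card {b : F // a ^ 2 + b ^ 2 = 0} : ℤ) = quadraticChar F (-a ^ 2) + 1 := by
      rw [← quadraticChar_card_sqrts hF, Set.toFinset_card, ← Nat.card_eq_fintype_card]
      congr 1
      exact Nat.card_congr (Equiv.subtypeEquivRight fun b => by
        simp [add_comm, eq_neg_iff_add_eq_zero])
    rw [hs]
    split_ifs with ha
    · simp [ha]
    · rw [neg_eq_neg_one_mul, map_mul, quadraticChar_sq_one' ha, mul_one]
  rw [Nat.card_congr (Equiv.subtypeProdEquivSigmaSubtype fun a b : F => a ^ 2 + b ^ 2 = 0),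
    Nat.card_sigma]
  push_cast
  rw [Finset.sum_congr rfl fun a _ => h a, Finset.sum_add_distrib, Finset.sum_ite]
  simp [Finset.filter_ne', Finset.card_erase_of_mem, Nat.cast_sub Fintype.card_pos]
  ring

variable {F} in
/-- The change of variables `(x₀, x₁, x₂, x₃) ↦ ((x₂, x₃), (x₁ - x₀, x₁ + x₀))` on the quadric
`-x₀² + x₁² + x₂² + x₃² = 0`. -/
def quadricEquivSigma (h2 : (2 : F) ≠ 0) :
    {v : Fin 4 → F // -(v 0) ^ 2 + (v 1) ^ 2 + (v 2) ^ 2 + (v 3) ^ 2 = 0} ≃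
      Σ p : F × F, {r : F × F // r.1 * r.2 = -(p.1 ^ 2 + p.2 ^ 2)} where
  toFun v := ⟨(v.1 2, v.1 3), (v.1 1 - v.1 0, v.1 1 + v.1 0), by linear_combination v.2⟩
  invFun x := ⟨![(x.2.1.2 - x.2.1.1) / 2, (x.2.1.2 + x.2.1.1) / 2, x.1.1, x.1.2], by
    have h := x.2.2
    simp
    field_simp
    linear_combination 4 * h⟩
  left_inv v := by
    ext i
    fin_cases i <;> simp <;> field_simp <;> ring
  right_inv := by
    rintro ⟨⟨c, d⟩, ⟨a, b⟩, h⟩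
    have h₁ : (b + a) / 2 - (b - a) / 2 = a := by field_simp; ring
    have h₂ : (b + a) / 2 + (b - a) / 2 = b := by field_simp; ring
    simp [h₁, h₂]

theorem card_affine_quadric [DecidableEq F] (hF : ringChar F ≠ 2) :
    (Nat.card {v : Fin 4 → F // -(v 0) ^ 2 + (v 1) ^ 2 + (v 2) ^ 2 + (v 3) ^ 2 = 0} : ℤ) =
      Fintype.card F ^ 3 +
        Fintype.card F * (Fintype.card F - 1) * quadraticChar F (-1) := by
  have hc := card_sq_add_sq_eq_zero F hF
  rw [Nat.card_eq_fintype_card, Fintype.card_subtype] at hc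
  rw [Nat.card_congr (quadricEquivSigma (Ring.two_ne_zero hF)), Nat.card_sigma]
  push_cast
  simp_rw [card_mul_eq, neg_eq_zero]
  rw [Finset.sum_add_distrib, ← Finset.sum_filter, Finset.sum_const, Finset.sum_const,
    nsmul_eq_mul, nsmul_eq_mul, hc]
  simp
  ring

theorem card_projective_quadric [DecidableEq F] (hF : ringChar F ≠ 2) :
    (Nat.card {p : ℙ F (Fin 4 → F) //
        -(p.rep 0) ^ 2 + (p.rep 1) ^ 2 + (p.rep 2) ^ 2 + (p.rep 3) ^ 2 = 0} : ℤ) =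
      1 + Fintype.card F + Fintype.card F * quadraticChar F (-1) + Fintype.card F ^ 2 := by
  let P : (Fin 4 → F) → Prop := fun v => -(v 0) ^ 2 + (v 1) ^ 2 + (v 2) ^ 2 + (v 3) ^ 2 = 0
  have hP (a : Fˣ) (v : Fin 4 → F) : P (a • v) ↔ P v := by
    have h : -((a • v) 0) ^ 2 + ((a • v) 1) ^ 2 + ((a • v) 2) ^ 2 + ((a • v) 3) ^ 2 =
        (a : F) ^ 2 * (-(v 0) ^ 2 + (v 1) ^ 2 + (v 2) ^ 2 + (v 3) ^ 2) := by
      simp only [Pi.smul_apply, Units.smul_def, smul_eq_mul]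
      ring
    simp only [P, h, mul_eq_zero, pow_eq_zero_iff two_ne_zero, a.ne_zero, false_or]
  have hproj := Projectivization.card_ne_zero_and_eq_mul_card_units P hP
  have hzero : Nat.card {v // P v} = Nat.card {v // v ≠ 0 ∧ P v} + 1 := by
    classical
    rw [Nat.card_eq_fintype_card, Nat.card_eq_fintype_card, Fintype.card_subtype,
      Fintype.card_subtype, ← Finset.card_erase_add_one (a := 0) (by simp [P])]
    congr 2
    ext v
    simp
  have haff : (Nat.card {v // P v} : ℤ) = _ := card_affine_quadric F hF
  have hq : 1 < Fintype.card F := Fintype.one_lt_card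
  rw [Nat.card_units, Nat.card_eq_fintype_card (α := F)] at hproj
  rw [hzero, hproj] at haff
  push_cast [Nat.cast_sub hq.le] at haff
  have hq' : (Fintype.card F : ℤ) - 1 ≠ 0 := by
    have : (1 : ℤ) < Fintype.card F := mod_cast hq
    linarith
  refine mul_right_cancel₀ hq' ?_
  linear_combination haff

end QuadricCount

/-- For every `s ≥ 1`, the number of points of the projective space
`ℙ³(F_{7^s})` on which the homogeneous polynomial
`f(X₀, X₁, X₂, X₃) = −X₀² + X₁² + X₂² + X₃²` vanishes equals `1 + 7ˢ + (−7)ˢ + 49ˢ`. -/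
theorem quadric_point_count (s : ℕ) (hs : 1 ≤ s) (F : Type*) [Field F] [Fintype F]
    (hF : Fintype.card F = 7 ^ s) :
    (Nat.card {p : ℙ F (Fin 4 → F) //
        -(p.rep 0) ^ 2 + (p.rep 1) ^ 2 + (p.rep 2) ^ 2 + (p.rep 3) ^ 2 = 0} : ℤ) =
      1 + 7 ^ s + (-7 : ℤ) ^ s + 49 ^ s := by
  classical
  have hchar : ringChar F ≠ 2 := fun h => by
    have := FiniteField.even_card_of_char_two h
    rw [hF, ← Nat.even_iff] at this
    exact absurd this (Nat.not_even_iff_odd.2 (Odd.pow (by decide)))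
  have hχ : quadraticChar F (-1) = (-1) ^ s := by
    rw [quadraticChar_neg_one hchar, hF, Nat.cast_pow, map_pow]
    rfl
  rw [card_projective_quadric F hchar, hχ, hF]
  push_cast
  rw [← mul_pow, ← pow_mul, mul_comm s 2, pow_mul]
  norm_num
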